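/- Let k be an infinite field with char k ≠ 2, let d ≥ 2 be an integer, and let I ⊆ R = k[x,y,z] be a proper homogeneous 𝔪-primary ideal generated by its degree-d homogeneous component, with dim_k I_d = 2d+1 and dim_k Soc(R/I) = 1. Then: (1) there exists a homogeneous ideal J ⊆ I generated by 3 homogeneous polynomials of degree d such that I^3 = J·I^2; and (2) for every homogeneous ideal J strictly contained in I one has I^2 ≠ J·I. (That is, the reduction number of I equals 2.) -/

import Mathlib

open MvPolynomial

/-- The maximal graded ideal `𝔪 = (x, y, z)` of `k[x,y,z]`. -/
noncomputable def mIdeal (k : Type*) [Field k] : Ideal (MvPolynomial (Fin 3) k) :=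
  Ideal.span (Set.range (X : Fin 3 → MvPolynomial (Fin 3) k))

/-- `dim_k Soc(R/I)`, the total dimension of the socle `(I : 𝔪)/I` of `R/I`. -/
noncomputable def socDim {k : Type*} [Field k] (I : Ideal (MvPolynomial (Fin 3) k)) : ℕ :=
  Module.finrank k
    ↥(Submodule.map (Ideal.Quotient.mkₐ k I).toLinearMap
      ((Submodule.colon I (mIdeal k)).restrictScalars k))

namespace GorensteinReduction

section Graded

attribute [local instance] MvPolynomial.gradedAlgebra

variable {σ k : Type*} [Field k]

lemma coe_decompose_eq (p : MvPolynomial σ k) (n : ℕ) :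
    (DirectSum.decompose (homogeneousSubmodule σ k) p n : MvPolynomial σ k) =
      homogeneousComponent n p :=
  decomposition.decompose'_apply p n

lemma homogeneousComponent_mul_left {p : MvPolynomial σ k} {m : ℕ} (hp : p.IsHomogeneous m)
    (q : MvPolynomial σ k) (n : ℕ) :
    homogeneousComponent (m + n) (p * q) = p * homogeneousComponent n q := by
  rw [← coe_decompose_eq, ← coe_decompose_eq]
  exact DirectSum.coe_decompose_mul_add_of_left_mem _ hp

lemma homogeneousComponent_mul_left_of_lt {p : MvPolynomial σ k} {m n : ℕ}
    (hp : p.IsHomogeneous m) (q : MvPolynomial σ k) (h : n < m) :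
    homogeneousComponent n (p * q) = 0 := by
  rw [← coe_decompose_eq]
  exact DirectSum.coe_decompose_mul_of_left_mem_of_not_le _ hp (by omega)

/-- An ideal of a polynomial ring containing the homogeneous components of its elements. -/
def IsGraded (I : Ideal (MvPolynomial σ k)) : Prop :=
  ∀ p ∈ I, ∀ n, homogeneousComponent n p ∈ I

lemma isGraded_span {S : Set (MvPolynomial σ k)} (hS : ∀ f ∈ S, ∃ n, f.IsHomogeneous n) :
    IsGraded (Ideal.span S) := fun _ hp n =>
  homogeneousComponent_mem_of_mem (Ideal.homogeneous_span _ _ fun f hf => hS f hf) hp n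

lemma IsGraded.sup {I J : Ideal (MvPolynomial σ k)} (hI : IsGraded I) (hJ : IsGraded J) :
    IsGraded (I ⊔ J) := by
  intro p hp n
  obtain ⟨a, ha, b, hb, rfl⟩ := Submodule.mem_sup.mp hp
  rw [map_add]
  exact Submodule.add_mem_sup (hI a ha n) (hJ b hb n)

end Graded

section Dimension

variable {k : Type*} [Field k]

instance finite_homogeneousSubmodule (n : ℕ) :
    Module.Finite k (homogeneousSubmodule (Fin 3) k n) :=
  Module.Finite.iff_fg.mpr (homogeneousSubmodule_fg _ _ n)

lemma finrank_homogeneousSubmodule (n : ℕ) :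
    Module.finrank k (homogeneousSubmodule (Fin 3) k n) = (n + 2).choose 2 := by
  have e : homogeneousSubmodule (Fin 3) k n ≃ₗ[k] ({d : Fin 3 →₀ ℕ | d.degree = n} →₀ k) := by
    rw [homogeneousSubmodule_eq_finsupp_supported]
    exact AddMonoidAlgebra.supportedEquivFinsupp _
  have hs : {d : Fin 3 →₀ ℕ | d.degree = n} =
      ((Finset.univ : Finset (Fin 3)).finsuppAntidiag n : Set _) := by
    ext d
    simp [Finset.mem_finsuppAntidiag, Finsupp.degree_eq_sum]
  rw [e.finrank_eq, hs, Module.finrank_finsupp_self]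
  simp only [Finset.coe_sort_coe, Fintype.card_coe, Finset.card_finsuppAntidiag_nat_eq_choose]
  rw [Finset.card_univ, Fintype.card_fin, show 3 + n - 1 = n + 2 by omega,
    ← Nat.choose_symm_add]

lemma two_mul_finrank_homogeneousSubmodule (n : ℕ) :
    2 * Module.finrank k (homogeneousSubmodule (Fin 3) k n) = (n + 2) * (n + 1) := by
  rw [finrank_homogeneousSubmodule, mul_comm, Nat.choose_two_right,
    Nat.div_mul_cancel (Nat.even_mul_pred_self _).two_dvd, Nat.add_sub_assoc (by omega)]

end Dimension

section Koszul

variable {k : Type*} [Field k]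

local notation "𝓡" => MvPolynomial (Fin 3) k

lemma not_X_dvd_X {i j : Fin 3} (h : i ≠ j) : ¬ (X i : 𝓡) ∣ X j := by
  simpa [X_dvd_X] using h

/-- The first Koszul relation: a vector proportional to `(x, y, z)` is a multiple of it. -/
lemma exists_eq_mul_X (a : Fin 3 → 𝓡) (h : ∀ i j, X i * a j = X j * a i) :
    ∃ c, ∀ i, a i = X i * c := by
  obtain ⟨c, hc⟩ : (X 0 : 𝓡) ∣ a 0 :=
    (X_prime.dvd_or_dvd ⟨a 1, (h 0 1).symm⟩).resolve_left (not_X_dvd_X (by decide))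
  refine ⟨c, fun i => mul_left_cancel₀ (X_ne_zero (R := k) (0 : Fin 3)) ?_⟩
  rw [h 0 i, hc]; ring

/-- The substitution `x ↦ 0`. -/
noncomputable def killX (k : Type*) [Field k] :
    MvPolynomial (Fin 3) k →ₐ[k] MvPolynomial (Fin 3) k :=
  aeval (fun i : Fin 3 => if i = 0 then 0 else X i)

lemma killX_X_zero : killX k (X 0) = 0 := by simp [killX]

lemma killX_X {i : Fin 3} (h : i ≠ 0) : killX k (X i) = X i := by simp [killX, h]

lemma exists_eq_killX_add (r : 𝓡) : ∃ a, r = killX k r + X 0 * a := by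
  induction r using MvPolynomial.induction_on with
  | C c => exact ⟨0, by simp [killX, algebraMap_eq]⟩
  | add p q hp hq =>
    obtain ⟨a, ha⟩ := hp
    obtain ⟨b, hb⟩ := hq
    refine ⟨a + b, ?_⟩
    rw [map_add]
    linear_combination ha + hb
  | mul_X p i hp =>
    obtain ⟨a, ha⟩ := hp
    rw [map_mul]
    by_cases hi : i = 0
    · subst hi
      exact ⟨p, by rw [killX_X_zero]; ring⟩
    · refine ⟨a * X i, ?_⟩
      rw [killX_X hi]
      linear_combination X i * ha

lemma X_dvd_of_X_dvd_relation {p q : 𝓡} (h : (X 0 : 𝓡) ∣ X 1 * p + X 2 * q) :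
    ∃ c a b, p = X 0 * a + X 2 * c ∧ q = X 0 * b - X 1 * c := by
  obtain ⟨e, he⟩ := h
  have h0 : X 1 * killX k p + X 2 * killX k q = 0 := by
    have := congrArg (killX k) he
    simpa [killX_X_zero, killX_X] using this
  obtain ⟨c, hc⟩ : (X 1 : 𝓡) ∣ killX k q :=
    (X_prime.dvd_or_dvd (a := X 2) (b := killX k q)
      ⟨- killX k p, by linear_combination h0⟩).resolve_left (not_X_dvd_X (by decide))
  obtain ⟨a, ha⟩ := exists_eq_killX_add p
  obtain ⟨b, hb⟩ := exists_eq_killX_add q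
  have h1 : killX k p = - (X 2 * c) := by
    refine mul_left_cancel₀ (X_ne_zero (R := k) (1 : Fin 3)) ?_
    rw [hc] at h0
    linear_combination h0
  exact ⟨-c, a, b, by linear_combination ha + h1, by linear_combination hb + hc⟩

/-- The second Koszul relation: a syzygy of `(x, y, z)` is a cross product with `(x, y, z)`. -/
lemma exists_cross_of_sum_X_mul (p : Fin 3 → 𝓡) (h : X 0 * p 0 + X 1 * p 1 + X 2 * p 2 = 0) :
    ∃ q : Fin 3 → 𝓡, p 0 = X 1 * q 2 - X 2 * q 1 ∧ p 1 = X 2 * q 0 - X 0 * q 2 ∧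
      p 2 = X 0 * q 1 - X 1 * q 0 := by
  obtain ⟨c, a, b, ha, hb⟩ := X_dvd_of_X_dvd_relation (p := p 1) (q := p 2)
    ⟨- p 0, by linear_combination h⟩
  refine ⟨![c, b, -a], ?_, ?_, ?_⟩
  · refine mul_left_cancel₀ (X_ne_zero (R := k) (0 : Fin 3)) ?_
    simp only [Matrix.cons_val]
    rw [ha, hb] at h
    linear_combination h
  · simp only [Matrix.cons_val]
    rw [ha]; ring
  · simp only [Matrix.cons_val]
    rw [hb]

lemma homogeneousComponent_X_mul (i : Fin 3) (q : 𝓡) (n : ℕ) :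
    homogeneousComponent (n + 1) (X i * q) = X i * homogeneousComponent n q := by
  rw [add_comm]
  exact homogeneousComponent_mul_left (isHomogeneous_X k i) q n

lemma exists_eq_X_mul_of_killX_eq_zero {n : ℕ} {p : 𝓡} (hp : p.IsHomogeneous (n + 1))
    (h : killX k p = 0) : ∃ a : 𝓡, a.IsHomogeneous n ∧ p = X 0 * a := by
  obtain ⟨a, ha⟩ := exists_eq_killX_add p
  refine ⟨homogeneousComponent n a, homogeneousComponent_isHomogeneous n a, ?_⟩
  rw [← homogeneousComponent_X_mul, show X 0 * a = p by linear_combination -h - ha,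
    homogeneousComponent_eq_self hp]

lemma exists_homogeneous_cross_of_sum_X_mul {n : ℕ} (p : Fin 3 → 𝓡)
    (hp : ∀ i, (p i).IsHomogeneous (n + 1))
    (h : X 0 * p 0 + X 1 * p 1 + X 2 * p 2 = 0) :
    ∃ q : Fin 3 → 𝓡, (∀ i, (q i).IsHomogeneous n) ∧
      p 0 = X 1 * q 2 - X 2 * q 1 ∧ p 1 = X 2 * q 0 - X 0 * q 2 ∧
      p 2 = X 0 * q 1 - X 1 * q 0 := by
  obtain ⟨q, h0, h1, h2⟩ := exists_cross_of_sum_X_mul p h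
  refine ⟨fun i => homogeneousComponent n (q i),
    fun i => homogeneousComponent_isHomogeneous n _, ?_, ?_, ?_⟩
  · rw [← homogeneousComponent_eq_self (hp 0), h0]
    simp only [map_sub, homogeneousComponent_X_mul]
  · rw [← homogeneousComponent_eq_self (hp 1), h1]
    simp only [map_sub, homogeneousComponent_X_mul]
  · rw [← homogeneousComponent_eq_self (hp 2), h2]
    simp only [map_sub, homogeneousComponent_X_mul]

end Koszul

section LinearAlgebra

variable {k M M' : Type*} [Field k] [AddCommGroup M] [Module k M] [AddCommGroup M'] [Module k M']

lemma finrank_map_add_finrank_inf_ker (V : Submodule k M) [Module.Finite k V] (f : M →ₗ[k] M') :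
    Module.finrank k (V.map f) + Module.finrank k ↥(V ⊓ LinearMap.ker f) =
      Module.finrank k V := by
  have h := (f.domRestrict V).finrank_range_add_finrank_ker
  rw [LinearMap.range_domRestrict, LinearMap.ker_domRestrict] at h
  rw [← h, (Submodule.equivSubtypeMap V _).finrank_eq, Submodule.map_comap_subtype]

lemma finrank_add_finrank_le_of_pairing (B : M →ₗ[k] M' →ₗ[k] k) (K : Submodule k M)
    (N V : Submodule k M') [Module.Finite k V] (hN : N ≤ V)
    (hzero : ∀ p ∈ K, ∀ q ∈ N, B p q = 0)
    (hinj : ∀ p ∈ K, (∀ q ∈ V, B p q = 0) → p = 0) :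
    Module.finrank k K + Module.finrank k N ≤ Module.finrank k V := by
  let T : K →ₗ[k] Module.Dual k V := (B.domRestrict₁₂ K V)
  have hT : Function.Injective T := by
    rw [injective_iff_map_eq_zero]
    intro p hp
    exact Subtype.ext (hinj p p.2 fun q hq => LinearMap.congr_fun hp ⟨q, hq⟩)
  have hle : LinearMap.range T ≤ (N.comap V.subtype).dualAnnihilator := by
    rintro _ ⟨p, rfl⟩
    rw [Submodule.mem_dualAnnihilator]
    intro q hq
    exact hzero p p.2 q hq
  have h1 := Submodule.finrank_mono hle
  rw [LinearMap.finrank_range_of_inj hT] at h1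
  have h2 := Subspace.finrank_add_finrank_dualAnnihilator_eq (N.comap V.subtype)
  have h3 : Module.finrank k (N.comap V.subtype) = Module.finrank k N :=
    (Submodule.comapSubtypeEquivOfLe hN).finrank_eq
  omega

end LinearAlgebra

section Dual

variable {k : Type*} [Field k]

local notation "𝓡" => MvPolynomial (Fin 3) k

/-- The functional `Λ`, concentrated in degree `s`, is a Macaulay dual generator of `I`. -/
structure IsDualGenerator (I : Ideal 𝓡) (s : ℕ) (Λ : Module.Dual k 𝓡) : Prop where
  apply_component : ∀ p, Λ p = Λ (homogeneousComponent s p)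
  mem_iff : ∀ p, p ∈ I ↔ ∀ q, Λ (p * q) = 0

lemma mem_colon_mIdeal_iff {I : Ideal 𝓡} {p : 𝓡} :
    p ∈ Submodule.colon I (mIdeal k : Set 𝓡) ↔ ∀ i, X i * p ∈ I := by
  rw [Submodule.mem_colon]
  constructor
  · intro h i
    rw [mul_comm]
    exact h _ (Ideal.subset_span ⟨i, rfl⟩)
  · intro h a ha
    have : mIdeal k ≤ Submodule.colon I {p} := by
      refine Ideal.span_le.mpr ?_
      rintro _ ⟨i, rfl⟩
      exact Submodule.mem_colon_singleton.mpr (h i)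
    rw [smul_eq_mul, mul_comm]
    exact Submodule.mem_colon_singleton.mp (this ha)

lemma mem_mIdeal_pow_of_isHomogeneous {p : 𝓡} {n m : ℕ} (hp : p.IsHomogeneous n) (h : m ≤ n) :
    p ∈ mIdeal k ^ m := by
  refine (mem_pow_idealOfVars_iff m p).mpr fun x hx => ?_
  exact h.trans (hp.degree_eq_sum_deg_support hx).le

lemma exists_isDualGenerator {I : Ideal 𝓡} (hI : IsGraded I)
    (hprim : ∃ N : ℕ, 1 ≤ N ∧ (mIdeal k) ^ N ≤ I) (hproper : I ≠ ⊤) (hsoc : socDim I = 1) :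
    ∃ s Λ, IsDualGenerator I s Λ := by
  classical
  obtain ⟨N, -, hN⟩ := hprim
  have hex : ∃ n, ∀ p : 𝓡, p.IsHomogeneous n → p ∈ I :=
    ⟨N, fun p hp => hN (mem_mIdeal_pow_of_isHomogeneous hp le_rfl)⟩
  obtain ⟨s, hs⟩ : ∃ s, Nat.find hex = s + 1 := by
    refine Nat.exists_eq_succ_of_ne_zero fun h0 => hproper ?_
    rw [Ideal.eq_top_iff_one]
    exact (Nat.find_eq_zero hex).mp h0 1 (isHomogeneous_one _ _)
  have hs1 : ∀ p : 𝓡, p.IsHomogeneous (s + 1) → p ∈ I := hs ▸ Nat.find_spec hex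
  have hs0 : ¬ ∀ p : 𝓡, p.IsHomogeneous s → p ∈ I := Nat.find_min hex (by omega)
  push Not at hs0
  obtain ⟨f, hf, hfI⟩ := hs0
  have hfsoc : ∀ i, X i * f ∈ I := fun i =>
    hs1 _ (by simpa [add_comm] using (isHomogeneous_X k i).mul hf)
  have hspan : ∀ p : 𝓡, (∀ i, X i * p ∈ I) → ∃ c : k, p - c • f ∈ I := by
    intro p hp
    have hmem : ∀ q : 𝓡, (∀ i, X i * q ∈ I) → Ideal.Quotient.mkₐ k I q ∈
        (Submodule.map (Ideal.Quotient.mkₐ k I).toLinearMap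
          ((Submodule.colon I (mIdeal k : Set 𝓡)).restrictScalars k)) := fun q hq =>
      ⟨q, mem_colon_mIdeal_iff.mpr hq, rfl⟩
    have hf0 : (⟨_, hmem f hfsoc⟩ : (Submodule.map (Ideal.Quotient.mkₐ k I).toLinearMap
          ((Submodule.colon I (mIdeal k : Set 𝓡)).restrictScalars k))) ≠ 0 := by
      intro h
      exact hfI (Ideal.Quotient.eq_zero_iff_mem.mp (congrArg Subtype.val h))
    obtain ⟨c, hc⟩ := (finrank_eq_one_iff_of_nonzero' _ hf0).mp hsoc ⟨_, hmem p hp⟩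
    refine ⟨c, Ideal.Quotient.eq_zero_iff_mem.mp ?_⟩
    have hc' := congrArg Subtype.val hc
    simp only [SetLike.val_smul, Ideal.Quotient.mkₐ_eq_mk] at hc'
    rw [map_sub, ← hc']
    change c • Ideal.Quotient.mkₐ k I f - Ideal.Quotient.mkₐ k I (c • f) = 0
    rw [map_smul, sub_self]
  obtain ⟨Λ, hΛf, hΛ⟩ := Submodule.exists_le_ker_of_notMem
    (p := (I.restrictScalars k).comap (homogeneousComponent s : 𝓡 →ₗ[k] 𝓡)) (v := f)
    (by simpa [homogeneousComponent_eq_self hf] using hfI)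
  have hΛI : ∀ p ∈ I, Λ p = 0 := fun p hp => hΛ (hI p hp s)
  refine ⟨s, Λ, fun p => ?_, fun p => ⟨fun hp q => hΛI _ (I.mul_mem_right q hp), ?_⟩⟩
  · rw [← sub_eq_zero, ← map_sub]
    refine hΛ ?_
    simp [homogeneousComponent_eq_self (homogeneousComponent_isHomogeneous s p)]
  · have key : ∀ n (p : 𝓡), (∀ a ∈ mIdeal k ^ n, a * p ∈ I) → (∀ q, Λ (p * q) = 0) → p ∈ I := by
      intro n
      induction n with
      | zero => intro p h _; simpa using h 1 (by simp)
      | succ n ih =>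
        intro p h hq
        obtain ⟨c, hc⟩ := hspan p fun i => ih _ (fun a ha => by
          rw [← mul_assoc]
          exact h _ (by
            rw [pow_succ]
            exact Ideal.mul_mem_mul ha (Ideal.subset_span ⟨i, rfl⟩)))
          (fun q => by
            rw [mul_right_comm, mul_comm]
            rw [mul_comm (X i)]; exact (by simpa [mul_assoc] using hq (q * X i)))
        have h0 := hΛI _ hc
        have h1 : Λ p = 0 := by simpa using hq 1
        rw [map_sub, map_smul, h1, zero_sub, neg_eq_zero, smul_eq_zero] at h0
        rw [h0.resolve_right hΛf] at hc
        simpa using hc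
    exact key N p fun a ha => I.mul_mem_right p (hN ha)

namespace IsDualGenerator

variable {I : Ideal (MvPolynomial (Fin 3) k)} {s : ℕ} {Λ : Module.Dual k (MvPolynomial (Fin 3) k)}

lemma mem_of_isHomogeneous (h : IsDualGenerator I s Λ) {i j : ℕ} (hij : i + j = s) {p : 𝓡}
    (hp : p.IsHomogeneous i) (hq : ∀ q : 𝓡, q.IsHomogeneous j → Λ (p * q) = 0) : p ∈ I := by
  rw [h.mem_iff]
  intro q
  rw [h.apply_component, ← hij, homogeneousComponent_mul_left hp]
  exact hq _ (homogeneousComponent_isHomogeneous j q)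

lemma mem_of_lt (h : IsDualGenerator I s Λ) {i : ℕ} (hi : s < i) {p : 𝓡}
    (hp : p.IsHomogeneous i) : p ∈ I := by
  rw [h.mem_iff]
  intro q
  rw [h.apply_component, homogeneousComponent_mul_left_of_lt hp _ hi, map_zero]

lemma apply_eq_zero (h : IsDualGenerator I s Λ) {p : 𝓡} (hp : p ∈ I) : Λ p = 0 := by
  simpa using (h.mem_iff p).mp hp 1

/-- Functionals on `R_i` vanishing on `I_i` are represented by forms of complementary degree. -/
lemma exists_eq_apply_mul (h : IsDualGenerator I s Λ) {i j : ℕ} (hij : i + j = s)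
    (ψ : Module.Dual k 𝓡) (hψ : ∀ p, ψ p = ψ (homogeneousComponent i p))
    (hψI : ∀ p ∈ I, p.IsHomogeneous i → ψ p = 0) :
    ∃ r : 𝓡, r.IsHomogeneous j ∧ ∀ p, ψ p = Λ (r * p) := by
  let T : 𝓡 →ₗ[k] Module.Dual k 𝓡 := (LinearMap.mul k 𝓡).compr₂ Λ
  let S : Submodule k (Module.Dual k 𝓡) := (homogeneousSubmodule (Fin 3) k j).map T
  have hS : ψ ∈ S.dualCoannihilator.dualAnnihilator := by
    rw [Submodule.mem_dualAnnihilator]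
    intro w hw
    rw [Submodule.mem_dualCoannihilator] at hw
    rw [hψ]
    refine hψI _ (h.mem_of_isHomogeneous hij (homogeneousComponent_isHomogeneous i w) ?_)
      (homogeneousComponent_isHomogeneous i w)
    intro q hq
    have := hw (T q) ⟨q, hq, rfl⟩
    change Λ (q * w) = 0 at this
    rwa [h.apply_component, ← hij, add_comm, homogeneousComponent_mul_left hq, mul_comm] at this
  rw [Subspace.dualCoannihilator_dualAnnihilator_eq] at hS
  obtain ⟨r, hr, hrψ⟩ := hS
  exact ⟨r, hr, fun p => by rw [← hrψ]; rfl⟩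

end IsDualGenerator
end Dual

section SocleDegree

variable {k : Type*} [Field k]

local notation "𝓡" => MvPolynomial (Fin 3) k
local notation "H" => homogeneousSubmodule (Fin 3) k

/-- The degree `n` component of an ideal, as a vector space. -/
noncomputable def degreePart (I : Ideal 𝓡) (n : ℕ) : Submodule k 𝓡 := I.restrictScalars k ⊓ H n

lemma mem_degreePart {I : Ideal 𝓡} {n : ℕ} {p : 𝓡} :
    p ∈ degreePart I n ↔ p ∈ I ∧ p.IsHomogeneous n := Iff.rfl

lemma degreePart_le (I : Ideal 𝓡) (n : ℕ) : degreePart I n ≤ H n := inf_le_right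

instance finite_degreePart (I : Ideal 𝓡) (n : ℕ) : Module.Finite k (degreePart I n) :=
  Submodule.finiteDimensional_of_le (degreePart_le I n)

lemma X_mul_mem_degreePart {I : Ideal 𝓡} {n : ℕ} {p : 𝓡} (hp : p ∈ degreePart I n) (i : Fin 3) :
    X i * p ∈ degreePart I (n + 1) :=
  ⟨I.mul_mem_left _ hp.1, by
    rw [add_comm]; exact (isHomogeneous_X k i).mul hp.2⟩

lemma finrank_lt_finrank_map_mul_X_sup {V : Submodule k 𝓡} [Module.Finite k V] (hV : V ≠ ⊥) :
    Module.finrank k V < Module.finrank k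
      ↥(V.map (LinearMap.mulLeft k (X 1 : 𝓡)) ⊔ V.map (LinearMap.mulLeft k (X 2 : 𝓡))) := by
  by_contra hlt
  have hinj : Function.Injective (LinearMap.mulLeft k (X 1 : 𝓡)) :=
    mul_right_injective₀ (X_ne_zero _)
  have heq := Submodule.eq_of_le_of_finrank_le (le_sup_left :
    V.map (LinearMap.mulLeft k (X 1 : 𝓡)) ≤ _ ⊔ V.map (LinearMap.mulLeft k (X 2 : 𝓡))) (by
      rw [← (Submodule.equivMapOfInjective _ hinj V).finrank_eq]
      omega)
  have hle : ∀ v ∈ V, ∃ w ∈ V, X 1 * w = X 2 * v := by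
    intro v hv
    have : X 2 * v ∈ V.map (LinearMap.mulLeft k (X 1 : 𝓡)) := by
      rw [heq]
      exact Submodule.mem_sup_right ⟨v, hv, rfl⟩
    exact this
  have hdvd : ∀ n : ℕ, ∀ v ∈ V, (X 1 : 𝓡) ^ n ∣ v := by
    intro n
    induction n with
    | zero => simp
    | succ n ih =>
      intro v hv
      obtain ⟨w, hw, hwv⟩ := hle v hv
      refine X_prime.pow_dvd_of_dvd_mul_left (n + 1) (b := v) (a := X 2)
        (not_X_dvd_X (by decide)) ?_
      rw [← hwv, pow_succ']
      exact mul_dvd_mul_left _ (ih w hw)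
  obtain ⟨v, hv, hv0⟩ := Submodule.exists_mem_ne_zero_of_ne_bot hV
  obtain ⟨n, hn⟩ := FiniteMultiplicity.of_prime_left (X_prime (R := k) (i := (1 : Fin 3))) hv0
  exact hn (hdvd _ v hv)

lemma finrank_map_killX_add_le (I : Ideal 𝓡) (n t : ℕ)
    (h : (degreePart I n).map (killX k).toLinearMap ≠ ⊥) :
    (degreePart I (n + t)).map (killX k).toLinearMap ≠ ⊥ ∧
    Module.finrank k ((degreePart I n).map (killX k).toLinearMap) + t ≤
      Module.finrank k ((degreePart I (n + t)).map (killX k).toLinearMap) := by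
  induction t with
  | zero => exact ⟨h, le_rfl⟩
  | succ t ih =>
    have hlt := finrank_lt_finrank_map_mul_X_sup ih.1
    have hX : ∀ i : Fin 3, i ≠ 0 → ((degreePart I (n + t)).map (killX k).toLinearMap).map
        (LinearMap.mulLeft k (X i : 𝓡)) ≤
        (degreePart I (n + (t + 1))).map (killX k).toLinearMap := by
      rintro i hi _ ⟨_, ⟨p, hp, rfl⟩, rfl⟩
      refine ⟨X i * p, X_mul_mem_degreePart hp i, ?_⟩
      simp [killX_X hi]
    have hle := Submodule.finrank_mono (sup_le (hX 1 (by decide)) (hX 2 (by decide)))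
    refine ⟨fun h0 => ?_, by omega⟩
    rw [h0, finrank_bot] at hle
    omega

namespace IsDualGenerator

variable {I : Ideal (MvPolynomial (Fin 3) k)} {s d : ℕ}
  {Λ : Module.Dual k (MvPolynomial (Fin 3) k)}

lemma two_mul_le_socle_degree (h : IsDualGenerator I s Λ) (hd : 2 ≤ d)
    (hrank : Module.finrank k (degreePart I d) = 2 * d + 1) : 2 * d ≤ s + 2 := by
  have h2 := two_mul_finrank_homogeneousSubmodule (k := k) d
  rcases lt_or_ge s d with hs | hs
  · have hle : H d ≤ degreePart I d := fun p hp => ⟨h.mem_of_lt hs hp, hp⟩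
    have := Submodule.finrank_mono hle
    nlinarith
  · obtain ⟨e, rfl⟩ := Nat.exists_eq_add_of_le hs
    let f : 𝓡 →ₗ[k] Module.Dual k (H e) :=
      (H e).dualRestrict ∘ₗ (LinearMap.mul k 𝓡).compr₂ Λ
    have hf := finrank_map_add_finrank_inf_ker (H d) f
    have hker : H d ⊓ LinearMap.ker f ≤ degreePart I d := by
      rintro p ⟨hp, hpf⟩
      refine ⟨h.mem_of_isHomogeneous rfl hp fun q hq => ?_, hp⟩
      exact LinearMap.congr_fun hpf ⟨q, hq⟩
    have h3 := Submodule.finrank_mono hker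
    have h4 := Submodule.finrank_le ((H d).map f)
    rw [Subspace.dual_finrank_eq] at h4
    have h5 := two_mul_finrank_homogeneousSubmodule (k := k) e
    by_contra hlt
    nlinarith

lemma socle_degree_le_two_mul (h : IsDualGenerator I s Λ) (hd : 2 ≤ d)
    (hlow : ∀ p ∈ I, ∀ j < d, p.IsHomogeneous j → p = 0)
    (hrank : Module.finrank k (degreePart I d) = 2 * d + 1)
    (hX : (degreePart I d).map (killX k).toLinearMap ≠ ⊥) : s + 2 ≤ 2 * d := by
  by_contra hlt
  obtain ⟨c, rfl⟩ : ∃ c, d = c + 1 := ⟨d - 1, by omega⟩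
  obtain ⟨t, rfl⟩ : ∃ t, s = c + (c + 1 + t) := ⟨s - (2 * c + 1), by omega⟩
  have hinj : Function.Injective (LinearMap.mulLeft k (X 0 : 𝓡)) :=
    mul_right_injective₀ (X_ne_zero _)
  let K : Submodule k 𝓡 := H c ⊓ (I.restrictScalars k).comap (LinearMap.mulLeft k (X 0))
  let N : Submodule k 𝓡 :=
    degreePart I (c + 1 + t) ⊔ (H (c + t)).map (LinearMap.mulLeft k (X 0))
  have hmulX : (H (c + t)).map (LinearMap.mulLeft k (X 0)) ≤ H (c + 1 + t) := by
    rintro _ ⟨p, hp, rfl⟩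
    have := (isHomogeneous_X k (0 : Fin 3)).mul hp
    rwa [show 1 + (c + t) = c + 1 + t by ring] at this
  have hN : N ≤ H (c + 1 + t) := sup_le (degreePart_le _ _) hmulX
  have : Module.Finite k K := Submodule.finiteDimensional_of_le (inf_le_left : K ≤ H c)
  have : Module.Finite k N := Submodule.finiteDimensional_of_le hN
  have hpair : Module.finrank k K + Module.finrank k N ≤ Module.finrank k (H (c + 1 + t)) := by
    refine finrank_add_finrank_le_of_pairing ((LinearMap.mul k 𝓡).compr₂ Λ) K N _ hN ?_ ?_
    · rintro p ⟨hp, hpX⟩ q hq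
      obtain ⟨a, ha, _, ⟨b, hb, rfl⟩, rfl⟩ := Submodule.mem_sup.mp hq
      change Λ (p * (a + X 0 * b)) = 0
      refine h.apply_eq_zero ?_
      rw [mul_add]
      refine I.add_mem (I.mul_mem_left _ ha.1) ?_
      rw [← mul_assoc, mul_comm p]
      exact I.mul_mem_right _ hpX
    · rintro p ⟨hp, hpX⟩ hq
      exact hlow p (h.mem_of_isHomogeneous rfl hp hq) c (by omega) hp
  have h1 := finrank_map_add_finrank_inf_ker (degreePart I (c + 1)) (killX k).toLinearMap
  have h2 : degreePart I (c + 1) ⊓ LinearMap.ker (killX k).toLinearMap ≤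
      K.map (LinearMap.mulLeft k (X 0)) := by
    rintro p ⟨⟨hpI, hp⟩, hpk⟩
    obtain ⟨a, ha, rfl⟩ := exists_eq_X_mul_of_killX_eq_zero hp hpk
    exact ⟨a, ⟨ha, hpI⟩, rfl⟩
  have h2' := Submodule.finrank_mono h2
  rw [← (Submodule.equivMapOfInjective _ hinj K).finrank_eq] at h2'
  have h3 := finrank_map_add_finrank_inf_ker N (killX k).toLinearMap
  have h4 := Submodule.finrank_mono (Submodule.map_mono (f := (killX k).toLinearMap)
    (le_sup_left : degreePart I (c + 1 + t) ≤ N))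
  have h5 : (H (c + t)).map (LinearMap.mulLeft k (X 0)) ≤
      N ⊓ LinearMap.ker (killX k).toLinearMap := by
    refine le_inf le_sup_right ?_
    rintro _ ⟨p, -, rfl⟩
    simp [killX_X_zero]
  have h5' := Submodule.finrank_mono h5
  rw [← (Submodule.equivMapOfInjective _ hinj _).finrank_eq] at h5'
  have h6 := (finrank_map_killX_add_le I (c + 1) t hX).2
  have h7 := two_mul_finrank_homogeneousSubmodule (k := k) (c + t)
  have h8 := two_mul_finrank_homogeneousSubmodule (k := k) (c + 1 + t)
  nlinarith

end IsDualGenerator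
end SocleDegree

section Generation

variable {k : Type*} [Field k]

local notation "𝓡" => MvPolynomial (Fin 3) k

lemma exists_sum_X_mul {n : ℕ} {p : 𝓡} (hp : p.IsHomogeneous (n + 1)) :
    ∃ a : Fin 3 → 𝓡, (∀ i, (a i).IsHomogeneous n) ∧ p = X 0 * a 0 + X 1 * a 1 + X 2 * a 2 := by
  have h : p ∈ mIdeal k := by
    simpa using mem_mIdeal_pow_of_isHomogeneous hp (show 1 ≤ n + 1 by omega)
  obtain ⟨c, hc⟩ := Ideal.mem_span_range_iff_exists_fun.mp h
  refine ⟨fun i => homogeneousComponent n (c i),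
    fun i => homogeneousComponent_isHomogeneous n _, ?_⟩
  rw [← homogeneousComponent_eq_self hp, ← hc, Fin.sum_univ_three]
  simp only [map_add, mul_comm (c _), homogeneousComponent_X_mul]

/-- To show that a linear map kills an ideal generated by forms of degree `d`, it is enough to
consider products of generators and homogeneous cofactors. -/
lemma apply_mem_of_mem_span {S : Set 𝓡} {M : Type*} [AddCommGroup M] [Module k M]
    (f : 𝓡 →ₗ[k] M) (W : Submodule k M) (h : ∀ g ∈ S, ∀ r, f (g * r) ∈ W) {p : 𝓡}
    (hp : p ∈ Ideal.span S) : f p ∈ W := by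
  have key : ∀ r, f (p * r) ∈ W := by
    induction hp using Submodule.span_induction with
    | mem x hx => exact h x hx
    | zero => simp
    | add x y _ _ hx hy =>
      intro r
      rw [add_mul, map_add]
      exact W.add_mem (hx r) (hy r)
    | smul a x _ hx =>
      intro r
      rw [smul_eq_mul, mul_comm a, mul_assoc]
      exact hx _
  simpa using key 1

/-- The sums `x a + y b + z c` with `a, b, c` in a given subspace. -/
noncomputable def mulX {M : Type*} [AddCommGroup M] [Module k M] [Module (MvPolynomial (Fin 3) k) M]
    [IsScalarTower k (MvPolynomial (Fin 3) k) M] (V : Submodule k M) : Submodule k M where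
  carrier := {x | ∃ a : Fin 3 → M, (∀ i, a i ∈ V) ∧
    x = (X 0 : 𝓡) • a 0 + (X 1 : 𝓡) • a 1 + (X 2 : 𝓡) • a 2}
  add_mem' := by
    rintro _ _ ⟨a, ha, rfl⟩ ⟨b, hb, rfl⟩
    refine ⟨a + b, fun i => V.add_mem (ha i) (hb i), ?_⟩
    simp only [Pi.add_apply, smul_add]
    abel
  zero_mem' := ⟨0, fun _ => V.zero_mem, by simp⟩
  smul_mem' := by
    rintro c _ ⟨a, ha, rfl⟩
    refine ⟨c • a, fun i => V.smul_mem c (ha i), ?_⟩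
    simp only [Pi.smul_apply, smul_add]
    rw [smul_algebra_smul_comm c (X 0 : 𝓡), smul_algebra_smul_comm c (X 1 : 𝓡),
      smul_algebra_smul_comm c (X 2 : 𝓡)]

lemma degreePart_succ_le_mulX {I : Ideal 𝓡} {d : ℕ}
    (hgen : I = Ideal.span (degreePart I d : Set 𝓡)) (t : ℕ) :
    degreePart I (d + (t + 1)) ≤ mulX (degreePart I (d + t)) := by
  rintro p ⟨hp, hpd⟩
  rw [← homogeneousComponent_eq_self hpd]
  have hp : p ∈ Ideal.span (degreePart I d : Set 𝓡) := by rw [← hgen]; exact hp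
  refine apply_mem_of_mem_span _ _ (fun g hg r => ?_) hp
  obtain ⟨b, hb, hbr⟩ := exists_sum_X_mul (homogeneousComponent_isHomogeneous (t + 1) r)
  rw [homogeneousComponent_mul_left hg.2, hbr]
  refine ⟨fun i => g * b i, fun i => ⟨I.mul_mem_right _ hg.1, hg.2.mul (hb i)⟩, ?_⟩
  simp only [smul_eq_mul]
  ring

lemma eq_zero_of_pow_dvd {p q : 𝓡} {m n : ℕ} (hp : p.IsHomogeneous m) (hmn : m < n)
    (h : q ∣ p) (hq : q.IsHomogeneous n) : p = 0 := by
  obtain ⟨b, rfl⟩ := h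
  rw [← homogeneousComponent_eq_self hp, homogeneousComponent_mul_left_of_lt hq _ hmn]

end Generation

section Square

variable {k : Type*} [Field k]

local notation "𝓡" => MvPolynomial (Fin 3) k

/-- Syzygies of `(x, y, z)` with entries in `I` of large degree come from Koszul syzygies with
entries in `I`; equivalently, the first syzygies of `I` are linear. -/
lemma IsDualGenerator.exists_cross_mem {I : Ideal 𝓡} {s d : ℕ} {Λ : Module.Dual k 𝓡}
    (h : IsDualGenerator I s Λ) (hlow : ∀ p ∈ I, ∀ j < d, p.IsHomogeneous j → p = 0)
    {m : ℕ} (hm : s + 2 ≤ m + d) (hm0 : m ≠ 0) (p : Fin 3 → 𝓡)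
    (hp : ∀ i, p i ∈ degreePart I (m + 1)) (hsum : X 0 * p 0 + X 1 * p 1 + X 2 * p 2 = 0) :
    ∃ q : Fin 3 → 𝓡, (∀ i, q i ∈ degreePart I m) ∧
      p 0 = X 1 * q 2 - X 2 * q 1 ∧ p 1 = X 2 * q 0 - X 0 * q 2 ∧
      p 2 = X 0 * q 1 - X 1 * q 0 := by
  obtain ⟨q, hq, h0, h1, h2⟩ := exists_homogeneous_cross_of_sum_X_mul p (fun i => (hp i).2) hsum
  rcases lt_or_ge s m with hs | hs
  · exact ⟨q, fun i => ⟨h.mem_of_lt hs (hq i), hq i⟩, h0, h1, h2⟩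
  obtain ⟨j, rfl⟩ := Nat.exists_eq_add_of_le hs
  obtain ⟨n, rfl⟩ := Nat.exists_eq_succ_of_ne_zero hm0
  let W : Submodule k (Fin 3 → 𝓡) :=
    { carrier := {v | ∃ u : 𝓡, u.IsHomogeneous n ∧ ∀ i, v i - X i * u ∈ I}
      add_mem' := by
        rintro v w ⟨a, ha, hva⟩ ⟨b, hb, hwb⟩
        refine ⟨a + b, ha.add hb, fun i => ?_⟩
        convert I.add_mem (hva i) (hwb i) using 1
        simp only [Pi.add_apply]
        ring
      zero_mem' := ⟨0, isHomogeneous_zero _ _ _, by simp⟩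
      smul_mem' := by
        rintro c v ⟨a, ha, hva⟩
        refine ⟨c • a, (homogeneousSubmodule (Fin 3) k n).smul_mem c ha, fun i => ?_⟩
        convert (I.restrictScalars k).smul_mem c (hva i) using 1
        simp [smul_sub] }
  have hqW : q ∈ W := by
    by_contra hqW
    obtain ⟨ψ, hψq, hψ⟩ := Submodule.exists_le_ker_of_notMem hqW
    have hψsum : ∀ v, ψ v = ∑ i, ψ (Pi.single i (v i)) := fun v => by
      rw [← map_sum, Finset.univ_sum_single]
    have hr : ∀ i : Fin 3, ∃ r : 𝓡, r.IsHomogeneous j ∧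
        ∀ p, ψ (Pi.single i (homogeneousComponent (n + 1) p)) = Λ (r * p) := by
      intro i
      refine h.exists_eq_apply_mul (i := n + 1) rfl
        (ψ ∘ₗ LinearMap.single k (fun _ => 𝓡) i ∘ₗ homogeneousComponent (n + 1)) ?_ ?_
      · intro p
        simp [homogeneousComponent_eq_self (homogeneousComponent_isHomogeneous (n + 1) p)]
      · intro p hpI hp
        refine hψ ⟨0, isHomogeneous_zero _ _ _, fun i' => ?_⟩
        simp only [LinearMap.coe_comp, Function.comp_apply, homogeneousComponent_eq_self hp,
          LinearMap.coe_single, mul_zero, sub_zero]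
        rcases eq_or_ne i' i with rfl | hne
        · simpa using hpI
        · simp [hne]
    choose r hrh hrΛ using hr
    have hψr : ∀ v : Fin 3 → 𝓡, (∀ i, (v i).IsHomogeneous (n + 1)) →
        ψ v = Λ (r 0 * v 0 + r 1 * v 1 + r 2 * v 2) := by
      intro v hv
      rw [hψsum, Fin.sum_univ_three, map_add, map_add, ← hrΛ, ← hrΛ, ← hrΛ]
      simp only [homogeneousComponent_eq_self (hv _)]
    have hXh : ∀ (i : Fin 3) {a : 𝓡} {l : ℕ}, a.IsHomogeneous l →
        (X i * a).IsHomogeneous (l + 1) := fun i a l ha => by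
      rw [add_comm]
      exact (isHomogeneous_X k i).mul ha
    have hXr : X 0 * r 0 + X 1 * r 1 + X 2 * r 2 = 0 := by
      have hh := ((hXh 0 (hrh 0)).add (hXh 1 (hrh 1))).add (hXh 2 (hrh 2))
      refine hlow _ (h.mem_of_isHomogeneous (i := j + 1) (j := n) (by omega) hh ?_) (j + 1)
        (by omega) hh
      intro u hu
      have hu0 : ψ (fun i => X i * u) = 0 := hψ ⟨u, hu, by simp⟩
      rw [hψr _ (fun i => hXh i hu)] at hu0
      rw [← hu0]
      congr 1
      ring
    obtain ⟨w, hw0, hw1, hw2⟩ := exists_cross_of_sum_X_mul r hXr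
    refine hψq ?_
    rw [hψr q hq]
    refine h.apply_eq_zero ?_
    have : r 0 * q 0 + r 1 * q 1 + r 2 * q 2 = - (w 0 * p 0 + w 1 * p 1 + w 2 * p 2) := by
      rw [hw0, hw1, hw2, h0, h1, h2]
      ring
    rw [this]
    exact I.neg_mem (I.add_mem (I.add_mem (I.mul_mem_left _ (hp 0).1)
      (I.mul_mem_left _ (hp 1).1)) (I.mul_mem_left _ (hp 2).1))
  obtain ⟨u, hu, huq⟩ := hqW
  refine ⟨fun i => q i - X i * u, fun i => ⟨huq i, (hq i).sub ?_⟩, ?_, ?_, ?_⟩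
  · have := (isHomogeneous_X k i).mul hu
    rwa [add_comm] at this
  · rw [h0]; ring
  · rw [h1]; ring
  · rw [h2]; ring

variable (I : Ideal (MvPolynomial (Fin 3) k)) (c : ℕ)
  (Λ φ : Module.Dual k (MvPolynomial (Fin 3) k))

/-- The degree `t` part of the graph of the homomorphism `I → R/I` attached to a functional `φ`
vanishing on the square of `I`. It lives in `R × R`, with `I` generated in degree `c + 2`. -/
noncomputable def graph : ℕ → Submodule k (MvPolynomial (Fin 3) k × MvPolynomial (Fin 3) k)
  | 0 =>
    { carrier := {x | x.1 ∈ degreePart I (c + 2) ∧ x.2.IsHomogeneous c ∧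
        ∀ g : MvPolynomial (Fin 3) k, g.IsHomogeneous (c + 2) → φ (x.1 * g) = Λ (x.2 * g)}
      add_mem' := by
        rintro x y ⟨hx, hx', hxg⟩ ⟨hy, hy', hyg⟩
        refine ⟨Submodule.add_mem _ hx hy, hx'.add hy', fun g hg => ?_⟩
        simp only [Prod.fst_add, Prod.snd_add, add_mul, map_add, hxg g hg, hyg g hg]
      zero_mem' := ⟨Submodule.zero_mem _, isHomogeneous_zero _ _ _, by simp⟩
      smul_mem' := by
        rintro a x ⟨hx, hx', hxg⟩
        refine ⟨Submodule.smul_mem _ a hx,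
          (homogeneousSubmodule (Fin 3) k c).smul_mem a hx', fun g hg => ?_⟩
        simp only [Prod.smul_fst, Prod.smul_snd, smul_mul_assoc, map_smul, hxg g hg] }
  | t + 1 => mulX (graph t)

variable {I c Λ φ}

lemma fst_mem_of_mem_graph {t : ℕ} {x : 𝓡 × 𝓡} (hx : x ∈ graph I c Λ φ t) :
    x.1 ∈ degreePart I (c + 2 + t) := by
  induction t generalizing x with
  | zero => exact hx.1
  | succ t ih =>
    obtain ⟨a, ha, rfl⟩ := hx
    exact Submodule.add_mem _ (Submodule.add_mem _ (X_mul_mem_degreePart (ih (ha 0)) 0)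
      (X_mul_mem_degreePart (ih (ha 1)) 1)) (X_mul_mem_degreePart (ih (ha 2)) 2)

lemma snd_isHomogeneous_of_mem_graph {t : ℕ} {x : 𝓡 × 𝓡} (hx : x ∈ graph I c Λ φ t) :
    x.2.IsHomogeneous (c + t) := by
  induction t generalizing x with
  | zero => exact hx.2.1
  | succ t ih =>
    obtain ⟨a, ha, rfl⟩ := hx
    have hX : ∀ i, (X i * (a i).2).IsHomogeneous (c + (t + 1)) := fun i => by
      rw [show c + (t + 1) = 1 + (c + t) by ring]
      exact (isHomogeneous_X k i).mul (ih (ha i))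
    exact ((hX 0).add (hX 1)).add (hX 2)

lemma exists_mem_graph (hgen : I = Ideal.span (degreePart I (c + 2) : Set 𝓡))
    (h0 : ∀ f ∈ degreePart I (c + 2), ∃ e, (f, e) ∈ graph I c Λ φ 0) {t : ℕ} {f : 𝓡}
    (hf : f ∈ degreePart I (c + 2 + t)) : ∃ e, (f, e) ∈ graph I c Λ φ t := by
  induction t generalizing f with
  | zero => exact h0 f hf
  | succ t ih =>
    obtain ⟨a, ha, rfl⟩ := degreePart_succ_le_mulX hgen t hf
    choose e he using fun i => ih (ha i)
    exact ⟨X 0 * e 0 + X 1 * e 1 + X 2 * e 2, fun i => (a i, e i), he, rfl⟩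

lemma X_smul_mem_graph {t : ℕ} {x : 𝓡 × 𝓡} (hx : x ∈ graph I c Λ φ t) (i : Fin 3) :
    (X i : 𝓡) • x ∈ graph I c Λ φ (t + 1) := by
  refine ⟨Pi.single i x, fun j => ?_, ?_⟩
  · rcases eq_or_ne j i with rfl | hne
    · simpa using hx
    · simp [hne]
  · fin_cases i <;> simp

lemma smul_mem_graph {t n : ℕ} {p : 𝓡} (hp : p.IsHomogeneous n) {x : 𝓡 × 𝓡}
    (hx : x ∈ graph I c Λ φ t) : p • x ∈ graph I c Λ φ (t + n) := by
  induction n generalizing p with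
  | zero =>
    have hp0 := homogeneousComponent_eq_self hp
    rw [homogeneousComponent_zero] at hp0
    rw [← hp0, ← algebraMap_eq, algebraMap_smul]
    exact Submodule.smul_mem _ _ hx
  | succ n ih =>
    obtain ⟨a, ha, rfl⟩ := exists_sum_X_mul hp
    refine ⟨fun i => a i • x, fun i => ih (ha i), ?_⟩
    simp only [smul_smul, add_smul]

lemma snd_eq_zero_of_mem_graph (h : IsDualGenerator I (2 * c + 2) Λ)
    (hgen : I = Ideal.span (degreePart I (c + 2) : Set 𝓡))
    (hlow : ∀ p ∈ I, ∀ j < c + 2, p.IsHomogeneous j → p = 0)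
    (h0 : ∀ f ∈ degreePart I (c + 2), ∃ e, (f, e) ∈ graph I c Λ φ 0) :
    ∀ (t : ℕ) (e : 𝓡), (0, e) ∈ graph I c Λ φ t → e = 0
  | 0, e, he => by
    refine hlow e (h.mem_of_isHomogeneous (i := c) (j := c + 2) (by omega) he.2.1 ?_) c
      (by omega) he.2.1
    intro g hg
    simpa using (he.2.2 g hg).symm
  | 1, e, he => by
    have hh : e.IsHomogeneous (c + 1) := snd_isHomogeneous_of_mem_graph he
    refine hlow e (h.mem_of_isHomogeneous (i := c + 1) (j := c + 1) (by omega) hh ?_) _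
      (by omega) hh
    intro g hg
    obtain ⟨a, ha, hae⟩ := he
    have h1 : (0 : 𝓡) = X 0 * (a 0).1 + X 1 * (a 1).1 + X 2 * (a 2).1 := congrArg Prod.fst hae
    have h2 : e = X 0 * (a 0).2 + X 1 * (a 1).2 + X 2 * (a 2).2 := congrArg Prod.snd hae
    have h3 : ∀ i, φ ((a i).1 * (X i * g)) = Λ ((a i).2 * (X i * g)) := fun i =>
      (ha i).2.2 _ (by
        rw [show c + 2 = 1 + (c + 1) by ring]
        exact (isHomogeneous_X k i).mul hg)
    have h4 : e * g = (a 0).2 * (X 0 * g) + (a 1).2 * (X 1 * g) + (a 2).2 * (X 2 * g) := by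
      rw [h2]; ring
    rw [h4, map_add, map_add, ← h3, ← h3, ← h3, ← map_add, ← map_add]
    have h5 : (a 0).1 * (X 0 * g) + (a 1).1 * (X 1 * g) + (a 2).1 * (X 2 * g) = 0 := by
      linear_combination -g * h1
    rw [h5, map_zero]
  | t + 2, e, he => by
    obtain ⟨a, ha, hae⟩ := he
    have h1 : (0 : 𝓡) = X 0 * (a 0).1 + X 1 * (a 1).1 + X 2 * (a 2).1 := congrArg Prod.fst hae
    have h2 : e = X 0 * (a 0).2 + X 1 * (a 1).2 + X 2 * (a 2).2 := congrArg Prod.snd hae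
    obtain ⟨q, hq, hq0, hq1, hq2⟩ := h.exists_cross_mem hlow (m := c + 2 + t) (by omega)
      (by omega) (fun i => (a i).1) (fun i => fst_mem_of_mem_graph (ha i)) h1.symm
    choose w hw using fun i => exists_mem_graph hgen h0 (hq i)
    have key : ∀ i j l : Fin 3, (a i).1 = X j * q l - X l * q j →
        (a i).2 = X j * w l - X l * w j := by
      intro i j l hi
      have hmem := Submodule.sub_mem _ (ha i) (Submodule.sub_mem _
        (X_smul_mem_graph (hw l) j) (X_smul_mem_graph (hw j) l))
      have heq : a i - ((X j : 𝓡) • (q l, w l) - (X l : 𝓡) • (q j, w j)) =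
          (0, (a i).2 - (X j * w l - X l * w j)) := by
        ext1
        · simp [hi]
        · simp
      rw [heq] at hmem
      exact sub_eq_zero.mp (snd_eq_zero_of_mem_graph h hgen hlow h0 (t + 1) _ hmem)
    rw [h2, key 0 1 2 hq0, key 1 2 0 hq1, key 2 0 1 hq2]
    ring

/-- A functional on forms of degree `2 (c + 2)` vanishing on products of two elements of `I`
vanishes on products of an element of `I` with any form. -/
lemma apply_mul_eq_zero (h : IsDualGenerator I (2 * c + 2) Λ)
    (hgen : I = Ideal.span (degreePart I (c + 2) : Set 𝓡))
    (hlow : ∀ p ∈ I, ∀ j < c + 2, p.IsHomogeneous j → p = 0)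
    (hφ : ∀ p, φ p = φ (homogeneousComponent (c + 2 + (c + 2)) p))
    (hφI : ∀ f ∈ degreePart I (c + 2), ∀ g ∈ degreePart I (c + 2), φ (f * g) = 0)
    {f g : 𝓡} (hf : f ∈ degreePart I (c + 2)) (hg : g.IsHomogeneous (c + 2)) :
    φ (f * g) = 0 := by
  have h0 : ∀ f ∈ degreePart I (c + 2), ∃ e, (f, e) ∈ graph I c Λ φ 0 := by
    intro f hf
    obtain ⟨e, he, hef⟩ := h.exists_eq_apply_mul (i := c + 2) (j := c) (by omega)
      (φ ∘ₗ LinearMap.mulLeft k f) (fun p => by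
        simp only [LinearMap.comp_apply, LinearMap.mulLeft_apply]
        rw [hφ, homogeneousComponent_mul_left hf.2])
      (fun p hpI hp => hφI f hf p ⟨hpI, hp⟩)
    exact ⟨e, hf, he, fun g _ => hef g⟩
  have hz := snd_eq_zero_of_mem_graph h hgen hlow h0
  have hcomm : ∀ {t t' : ℕ} {x y : 𝓡 × 𝓡}, x ∈ graph I c Λ φ t → y ∈ graph I c Λ φ t' →
      x.1 * y.2 = y.1 * x.2 := by
    intro t t' x y hx hy
    have h1 := smul_mem_graph (fst_mem_of_mem_graph hx).2 hy
    have h2 := smul_mem_graph (fst_mem_of_mem_graph hy).2 hx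
    rw [show t + (c + 2 + t') = t' + (c + 2 + t) by ring] at h2
    have h3 := Submodule.sub_mem _ h1 h2
    have heq : x.1 • y - y.1 • x = (0, x.1 * y.2 - y.1 * x.2) := by
      ext1
      · simp [mul_comm]
      · simp
    rw [heq] at h3
    exact sub_eq_zero.mp (hz _ _ h3)
  have hpow : ∀ i : Fin 3, ∃ e, ((X i : 𝓡) ^ (c + 2 + (c + 1)), e) ∈ graph I c Λ φ (c + 1) :=
    fun i => exists_mem_graph hgen h0
      ⟨h.mem_of_lt (by omega) (isHomogeneous_X_pow i _), isHomogeneous_X_pow i _⟩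
  obtain ⟨e, he⟩ := hpow 0
  obtain ⟨e', he'⟩ := hpow 1
  have hdvd : (X 0 : 𝓡) ^ (c + 2 + (c + 1)) ∣ e := by
    refine X_prime.pow_dvd_of_dvd_mul_left _ (a := X 1 ^ (c + 2 + (c + 1)))
      (fun hd => not_X_dvd_X (by decide) (X_prime.dvd_of_dvd_pow hd)) ⟨e', (hcomm he he').symm⟩
  have he0 : e = 0 := eq_zero_of_pow_dvd (snd_isHomogeneous_of_mem_graph he) (by omega) hdvd
    (isHomogeneous_X_pow 0 _)
  obtain ⟨u, hu⟩ := h0 f hf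
  have hu0 : u = 0 := by
    have := hcomm he hu
    rw [he0] at this
    simpa using this
  have := hu.2.2 g hg
  simpa [hu0] using this

/-- All forms of degree `2 (c + 2)` are combinations of products of generators of `I`. -/
lemma homogeneousSubmodule_le_mul (h : IsDualGenerator I (2 * c + 2) Λ)
    (hgen : I = Ideal.span (degreePart I (c + 2) : Set 𝓡))
    (hlow : ∀ p ∈ I, ∀ j < c + 2, p.IsHomogeneous j → p = 0) :
    homogeneousSubmodule (Fin 3) k (c + 2 + (c + 2)) ≤
      degreePart I (c + 2) * degreePart I (c + 2) := by
  intro p hp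
  by_contra hpI
  obtain ⟨φ, hφp, hφ⟩ := Submodule.exists_le_ker_of_notMem hpI
  have hpmem : p ∈ Ideal.span (degreePart I (c + 2) : Set 𝓡) :=
    by rw [← hgen]; exact h.mem_of_lt (by omega) hp
  have hcomp : ∀ q : 𝓡, homogeneousComponent (c + 2 + (c + 2))
      (homogeneousComponent (c + 2 + (c + 2)) q) = homogeneousComponent (c + 2 + (c + 2)) q :=
    fun q => homogeneousComponent_eq_self (homogeneousComponent_isHomogeneous _ q)
  have hzero := apply_mem_of_mem_span (φ ∘ₗ homogeneousComponent (c + 2 + (c + 2))) ⊥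
    (fun g hg r => by
      have := apply_mul_eq_zero (φ := φ ∘ₗ homogeneousComponent (c + 2 + (c + 2))) h hgen hlow
        (fun q => by simp [hcomp]) (fun f hf g hg => by
          rw [LinearMap.comp_apply, homogeneousComponent_eq_self (hf.2.mul hg.2)]
          exact hφ (Submodule.mul_mem_mul hf hg)) hg (homogeneousComponent_isHomogeneous (c + 2) r)
      rw [LinearMap.comp_apply, ← homogeneousComponent_mul_left hg.2, hcomp] at this
      simpa using this) hpmem
  rw [Submodule.mem_bot, LinearMap.comp_apply, homogeneousComponent_eq_self hp] at hzero
  exact hφp hzero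

end Square

section ProductDimension

variable {k A : Type*} [Field k] [CommRing A] [Algebra k A]

lemma exists_hyperplane {U W : Submodule k A} [Module.Finite k W] (h : U < W) :
    ∃ (V : Submodule k A) (w : A), U ≤ V ∧ V ≤ W ∧ w ∈ W ∧ W = V ⊔ Submodule.span k {w} ∧
      Module.finrank k V + 1 = Module.finrank k W := by
  obtain ⟨w, hwW, hwU⟩ := SetLike.exists_of_lt h
  obtain ⟨φ, hφw, hφ⟩ := Submodule.exists_le_ker_of_notMem hwU
  refine ⟨W ⊓ LinearMap.ker φ, w, le_inf h.le hφ, inf_le_left, hwW, le_antisymm ?_ ?_, ?_⟩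
  · intro v hv
    have hmem : v - (φ v / φ w) • w ∈ W ⊓ LinearMap.ker φ :=
      ⟨W.sub_mem hv (W.smul_mem _ hwW), by simp [hφw]⟩
    rw [← sub_add_cancel v ((φ v / φ w) • w)]
    exact Submodule.add_mem_sup hmem
      (Submodule.smul_mem _ _ (Submodule.mem_span_singleton_self w))
  · exact sup_le inf_le_left (by simpa using hwW)
  · have hmap : W.map φ = ⊤ := by
      rw [eq_top_iff]
      intro c _
      exact ⟨(c / φ w) • w, W.smul_mem _ hwW, by simp [hφw]⟩
    have := finrank_map_add_finrank_inf_ker W φ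
    rw [hmap, finrank_top, Module.finrank_self] at this
    omega

lemma finite_mul (V W : Submodule k A) [Module.Finite k V] [Module.Finite k W] :
    Module.Finite k ↥(V * W) :=
  Module.Finite.iff_fg.mpr
    ((Module.Finite.iff_fg.mp ‹Module.Finite k V›).mul (Module.Finite.iff_fg.mp ‹_›))

lemma mul_span_singleton_eq_map (V : Submodule k A) (w : A) :
    V * Submodule.span k {w} = V.map (LinearMap.mulRight k w) := by
  refine le_antisymm (Submodule.mul_le.mpr fun v hv x hx => ?_) ?_
  · obtain ⟨c, rfl⟩ := Submodule.mem_span_singleton.mp hx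
    exact ⟨c • v, V.smul_mem c hv, by simp⟩
  · rintro _ ⟨v, hv, rfl⟩
    exact Submodule.mul_mem_mul hv (Submodule.mem_span_singleton_self w)

lemma finrank_mul_span_singleton_le (V : Submodule k A) [Module.Finite k V] (w : A) :
    Module.finrank k ↥(V * Submodule.span k {w}) ≤ Module.finrank k V := by
  rw [mul_span_singleton_eq_map]
  exact Submodule.finrank_map_le _ _

lemma two_mul_finrank_mul_self_le (n : ℕ) (W : Submodule k A) [Module.Finite k W]
    (hn : Module.finrank k W = n) : 2 * Module.finrank k ↥(W * W) ≤ n * (n + 1) := by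
  induction n generalizing W with
  | zero =>
    rw [Submodule.finrank_eq_zero] at hn
    rw [hn, Submodule.bot_mul]
    simp
  | succ n ih =>
    have hW : ⊥ < W := by
      rw [bot_lt_iff_ne_bot]
      rintro rfl
      simp at hn
    obtain ⟨V, w, -, hVW, -, hsup, hrank⟩ := exists_hyperplane hW
    have : Module.Finite k V := Submodule.finiteDimensional_of_le hVW
    have := finite_mul V V
    have := finite_mul V (Submodule.span k {w})
    have := finite_mul W (Submodule.span k {w})
    have hprod : W * W = V * V ⊔ W * Submodule.span k {w} := by
      refine le_antisymm ?_ (sup_le (mul_le_mul' hVW hVW)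
        (mul_le_mul' le_rfl (hsup ▸ le_sup_right)))
      conv_lhs => rw [hsup]
      rw [Submodule.sup_mul, Submodule.mul_sup]
      refine sup_le (sup_le le_sup_left (le_sup_of_le_right (mul_le_mul' hVW le_rfl))) ?_
      rw [← hsup, mul_comm]
      exact le_sup_right
    have h1 := Submodule.finrank_add_le_finrank_add_finrank (V * V) (W * Submodule.span k {w})
    have h2 := finrank_mul_span_singleton_le W w
    have h3 := ih V (by omega)
    rw [hprod]
    nlinarith

lemma two_mul_finrank_mul_lt {U W : Submodule k A} [Module.Finite k W] (h : U < W) :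
    2 * Module.finrank k ↥(U * W) < Module.finrank k W * (Module.finrank k W + 1) := by
  obtain ⟨V, w, hUV, hVW, -, hsup, hrank⟩ := exists_hyperplane h
  have : Module.Finite k V := Submodule.finiteDimensional_of_le hVW
  have := finite_mul V V
  have := finite_mul V W
  have := finite_mul V (Submodule.span k {w})
  have hprod : V * W = V * V ⊔ V * Submodule.span k {w} := by
    conv_lhs => rw [hsup]
    rw [Submodule.mul_sup]
  have h0 := Submodule.finrank_mono (mul_le_mul' hUV le_rfl : U * W ≤ V * W)
  have h1 := Submodule.finrank_add_le_finrank_add_finrank (V * V) (V * Submodule.span k {w})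
  rw [← hprod] at h1
  have h2 := finrank_mul_span_singleton_le V w
  have h3 := two_mul_finrank_mul_self_le _ V rfl
  rw [← hrank]
  nlinarith

end ProductDimension

section RegularSequence

variable {k : Type*} [Field k]

local notation "𝓡" => MvPolynomial (Fin 3) k

/-- Generic forms in `I` are regular modulo an ideal whose quotient has no socle. -/
lemma exists_regular [Infinite k] {I 𝔞 : Ideal 𝓡} {d N : ℕ}
    (hgen : I = Ideal.span (degreePart I d : Set 𝓡)) (hX : ∀ i, X i ^ N ∈ I)
    (hsat : ∀ u, (∀ i, X i * u ∈ 𝔞) → u ∈ 𝔞) :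
    ∃ g ∈ degreePart I d, ∀ p, g * p ∈ 𝔞 → p ∈ 𝔞 := by
  have hfin := associatedPrimes.finite 𝓡 (𝓡 ⧸ 𝔞)
  have : Finite (associatedPrimes 𝓡 (𝓡 ⧸ 𝔞)) := hfin
  let V : associatedPrimes 𝓡 (𝓡 ⧸ 𝔞) → Subspace k (degreePart I d) := fun P =>
    (P.1.restrictScalars k).comap (degreePart I d).subtype
  have hV : ∀ P, V P ≠ ⊤ := by
    rintro ⟨P, hP⟩ htop
    have hIP : I ≤ P := by
      rw [hgen, Ideal.span_le]
      intro g hg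
      have : (⟨g, hg⟩ : degreePart I d) ∈ V ⟨P, hP⟩ := htop ▸ Submodule.mem_top
      exact this
    rw [AssociatedPrimes.mem_iff, isAssociatedPrime_iff] at hP
    obtain ⟨hprime, x, hx⟩ := hP
    obtain ⟨u, rfl⟩ := Ideal.Quotient.mk_surjective x
    have hmem : ∀ q, q ∈ P ↔ q * u ∈ 𝔞 := fun q => by
      rw [hx, Submodule.mem_colon_singleton, Submodule.mem_bot, ← Ideal.Quotient.eq_zero_iff_mem,
        map_mul]
      rfl
    have hu := hsat u fun i => (hmem _).mp (hprime.mem_of_pow_mem _ (hIP (hX i)))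
    exact hprime.ne_top ((Ideal.eq_top_iff_one _).mpr ((hmem 1).mpr (by simpa using hu)))
  have hne : ⋃ P, (V P : Set (degreePart I d)) ≠ Set.univ := fun hcov => by
    obtain ⟨P, hP⟩ := Subspace.exists_eq_top_of_iUnion_eq_univ hcov
    exact hV P hP
  obtain ⟨g, hg⟩ := (Set.ne_univ_iff_exists_notMem _).mp hne
  refine ⟨g, g.2, fun p hp => ?_⟩
  by_contra hpa
  have hzd : (g : 𝓡) ∈ {r : 𝓡 | ∃ x : 𝓡 ⧸ 𝔞, x ≠ 0 ∧ r • x = 0} :=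
    ⟨Ideal.Quotient.mk 𝔞 p, fun h0 => hpa (Ideal.Quotient.eq_zero_iff_mem.mp h0),
      Ideal.Quotient.eq_zero_iff_mem.mpr hp⟩
  rw [← biUnion_associatedPrimes_eq_zero_divisors] at hzd
  obtain ⟨P, hP, hgP⟩ := Set.mem_iUnion₂.mp hzd
  exact hg (Set.mem_iUnion.mpr ⟨⟨P, hP⟩, hgP⟩)

lemma mem_span_singleton_of_X_mul_mem {g u : 𝓡} (hg : g ≠ 0)
    (h : ∀ i, X i * u ∈ Ideal.span {g}) : u ∈ Ideal.span {g} := by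
  choose a ha using fun i => Ideal.mem_span_singleton'.mp (h i)
  obtain ⟨c, hc⟩ := exists_eq_mul_X a fun i j => mul_right_cancel₀ hg (by
    linear_combination X i * ha j - X j * ha i)
  refine Ideal.mem_span_singleton'.mpr ⟨c, mul_left_cancel₀ (X_ne_zero (R := k) (0 : Fin 3)) ?_⟩
  rw [← ha 0, hc 0]
  ring

lemma mem_sup_span_singleton_of_X_mul_mem {g g' u : 𝓡} (hg : g ≠ 0)
    (hreg : ∀ p, g' * p ∈ Ideal.span {g} → p ∈ Ideal.span {g})
    (h : ∀ i, X i * u ∈ Ideal.span {g} ⊔ Ideal.span {g'}) :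
    u ∈ Ideal.span {g} ⊔ Ideal.span {g'} := by
  have h' : ∀ i, ∃ a b, X i * u = a * g + b * g' := fun i => by
    obtain ⟨x, hx, y, hy, hxy⟩ := Submodule.mem_sup.mp (h i)
    obtain ⟨a, rfl⟩ := Ideal.mem_span_singleton'.mp hx
    obtain ⟨b, rfl⟩ := Ideal.mem_span_singleton'.mp hy
    exact ⟨a, b, hxy.symm⟩
  choose a b hab using h'
  have hcross : ∀ i j, ∃ c, c * g = X i * b j - X j * b i := fun i j =>
    Ideal.mem_span_singleton'.mp (hreg _ (Ideal.mem_span_singleton'.mpr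
      ⟨X j * a i - X i * a j, by linear_combination X i * hab j - X j * hab i⟩))
  obtain ⟨c0, hc0⟩ := hcross 1 2
  obtain ⟨c1, hc1⟩ := hcross 2 0
  obtain ⟨c2, hc2⟩ := hcross 0 1
  obtain ⟨e, he0, he1, he2⟩ := exists_cross_of_sum_X_mul ![c0, c1, c2] (mul_right_cancel₀ hg (by
    simp only [Matrix.cons_val]
    linear_combination X 0 * hc0 + X 1 * hc1 + X 2 * hc2))
  simp only [Matrix.cons_val] at he0 he1 he2
  obtain ⟨β, hβ⟩ := exists_eq_mul_X (fun i => b i - g * e i) (by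
    have h0 : X 1 * (b 2 - g * e 2) = X 2 * (b 1 - g * e 1) := by
      linear_combination g * he0 - hc0
    have h1 : X 2 * (b 0 - g * e 0) = X 0 * (b 2 - g * e 2) := by
      linear_combination g * he1 - hc1
    have h2 : X 0 * (b 1 - g * e 1) = X 1 * (b 0 - g * e 0) := by
      linear_combination g * he2 - hc2
    intro i j
    fin_cases i <;> fin_cases j <;>
      first | rfl | exact h0 | exact h1 | exact h2 | exact h0.symm | exact h1.symm | exact h2.symm)
  have hα : ∀ i, (a i + e i * g') * g = X i * (u - β * g') := fun i => by
    linear_combination -g' * hβ i - hab i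
  obtain ⟨α, hα'⟩ := exists_eq_mul_X (fun i => a i + e i * g') fun i j => mul_right_cancel₀ hg (by
    linear_combination X i * hα j - X j * hα i)
  have hu : u = α * g + β * g' := mul_left_cancel₀ (X_ne_zero (R := k) (0 : Fin 3)) (by
    linear_combination g * hα' 0 - hα 0)
  rw [hu]
  exact Submodule.add_mem_sup (Ideal.mem_span_singleton'.mpr ⟨α, rfl⟩)
    (Ideal.mem_span_singleton'.mpr ⟨β, rfl⟩)

lemma finrank_degreePart_sup_span_singleton {𝔞 : Ideal 𝓡} (h𝔞 : IsGraded 𝔞) {g : 𝓡} {d : ℕ}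
    (hg : g.IsHomogeneous d) (hg0 : g ≠ 0) (hreg : ∀ p, g * p ∈ 𝔞 → p ∈ 𝔞) (t : ℕ) :
    Module.finrank k (degreePart (𝔞 ⊔ Ideal.span {g}) (d + t)) +
        Module.finrank k (degreePart 𝔞 t) =
      Module.finrank k (degreePart 𝔞 (d + t)) +
        Module.finrank k (homogeneousSubmodule (Fin 3) k t) := by
  have hinj : Function.Injective (LinearMap.mulLeft k g) := mul_right_injective₀ hg0
  have hsup : degreePart (𝔞 ⊔ Ideal.span {g}) (d + t) =
      degreePart 𝔞 (d + t) ⊔ (homogeneousSubmodule (Fin 3) k t).map (LinearMap.mulLeft k g) := by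
    refine le_antisymm ?_ (sup_le ?_ ?_)
    · rintro p ⟨hp, hpd⟩
      obtain ⟨a, ha, b, hb, rfl⟩ := Submodule.mem_sup.mp hp
      obtain ⟨c, rfl⟩ := Ideal.mem_span_singleton'.mp hb
      rw [← homogeneousComponent_eq_self hpd, map_add, mul_comm c,
        homogeneousComponent_mul_left hg]
      exact Submodule.add_mem_sup ⟨h𝔞 a ha _, homogeneousComponent_isHomogeneous _ a⟩
        ⟨_, homogeneousComponent_isHomogeneous t c, rfl⟩
    · exact fun p hp => ⟨Submodule.mem_sup_left hp.1, hp.2⟩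
    · rintro _ ⟨p, hp, rfl⟩
      exact ⟨Submodule.mem_sup_right (Ideal.mul_mem_right _ _ (Ideal.mem_span_singleton_self g)),
        hg.mul hp⟩
  have hinf : degreePart 𝔞 (d + t) ⊓
      (homogeneousSubmodule (Fin 3) k t).map (LinearMap.mulLeft k g) =
      (degreePart 𝔞 t).map (LinearMap.mulLeft k g) := by
    refine le_antisymm ?_ ?_
    · rintro _ ⟨hp, q, hq, rfl⟩
      exact ⟨q, ⟨hreg q hp.1, hq⟩, rfl⟩
    · rintro _ ⟨q, hq, rfl⟩
      exact ⟨⟨𝔞.mul_mem_left _ hq.1, hg.mul hq.2⟩, q, hq.2, rfl⟩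
  have := Submodule.finrank_sup_add_finrank_inf_eq (degreePart 𝔞 (d + t))
    ((homogeneousSubmodule (Fin 3) k t).map (LinearMap.mulLeft k g))
  rwa [← hsup, hinf, ← (Submodule.equivMapOfInjective _ hinj _).finrank_eq,
    ← (Submodule.equivMapOfInjective _ hinj _).finrank_eq] at this

lemma isGraded_span_singleton {g : 𝓡} {d : ℕ} (hg : g.IsHomogeneous d) :
    IsGraded (Ideal.span {g}) :=
  isGraded_span fun f hf => ⟨d, by rw [Set.mem_singleton_iff.mp hf]; exact hg⟩

/-- A regular sequence of three forms of degree `d` generates all forms of degree `3 d`. -/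
lemma homogeneousSubmodule_le_of_regular {g₀ g₁ g₂ : 𝓡} {d : ℕ} (hg₀ : g₀.IsHomogeneous d)
    (hg₁ : g₁.IsHomogeneous d) (hg₂ : g₂.IsHomogeneous d) (h₀ : g₀ ≠ 0) (h₁ : g₁ ≠ 0) (h₂ : g₂ ≠ 0)
    (hreg₁ : ∀ p, g₁ * p ∈ Ideal.span {g₀} → p ∈ Ideal.span {g₀})
    (hreg₂ : ∀ p, g₂ * p ∈ Ideal.span {g₀} ⊔ Ideal.span {g₁} →
      p ∈ Ideal.span {g₀} ⊔ Ideal.span {g₁})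
    {p : 𝓡} (hp : p.IsHomogeneous (d + (d + d))) :
    p ∈ Ideal.span {g₀} ⊔ Ideal.span {g₁} ⊔ Ideal.span {g₂} := by
  have hbot : ∀ n, Module.finrank k (degreePart (⊥ : Ideal 𝓡) n) = 0 := fun n => by
    rw [Submodule.finrank_eq_zero, eq_bot_iff]
    exact fun q hq => hq.1
  have e₀ : ∀ t, Module.finrank k (degreePart (Ideal.span {g₀}) (d + t)) =
      Module.finrank k (homogeneousSubmodule (Fin 3) k t) := fun t => by
    have := finrank_degreePart_sup_span_singleton (𝔞 := ⊥)
      (fun p hp n => by simp [Ideal.mem_bot.mp hp]) hg₀ h₀ (fun p hp => by simpa [h₀] using hp) t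
    rwa [bot_sup_eq, hbot, hbot, add_zero, zero_add] at this
  have e₁ := finrank_degreePart_sup_span_singleton (isGraded_span_singleton hg₀) hg₁ h₁ hreg₁
  have e₂ := finrank_degreePart_sup_span_singleton
    ((isGraded_span_singleton hg₀).sup (isGraded_span_singleton hg₁)) hg₂ h₂ hreg₂ (d + d)
  have heq : degreePart (Ideal.span {g₀} ⊔ Ideal.span {g₁} ⊔ Ideal.span {g₂}) (d + (d + d)) =
      homogeneousSubmodule (Fin 3) k (d + (d + d)) := by
    refine Submodule.eq_of_le_of_finrank_eq (degreePart_le _ _) ?_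
    have a0 := e₀ 0
    have ad := e₀ d
    have a2 := e₀ (d + d)
    have b1 := e₁ d
    have b2 := e₁ (d + d)
    rw [add_zero] at a0
    have c0 := two_mul_finrank_homogeneousSubmodule (k := k) 0
    have c1 := two_mul_finrank_homogeneousSubmodule (k := k) d
    have c2 := two_mul_finrank_homogeneousSubmodule (k := k) (d + d)
    have c3 := two_mul_finrank_homogeneousSubmodule (k := k) (d + (d + d))
    linarith
  exact (heq.ge hp).1

end RegularSequence

section Reduction

variable {k : Type*} [Field k]

local notation "𝓡" => MvPolynomial (Fin 3) k

lemma degreePart_mul_le {I J : Ideal 𝓡} {d : ℕ} (hI : IsGraded I) (hJ : IsGraded J) (hJI : J ≤ I)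
    (hlow : ∀ p ∈ I, ∀ j < d, p.IsHomogeneous j → p = 0) :
    degreePart (J * I) (d + d) ≤ degreePart J d * degreePart I d := by
  rintro p ⟨hp, hpd⟩
  rw [← homogeneousComponent_eq_self hpd]
  replace hp : p ∈ J * I := hp
  clear hpd
  induction hp using Submodule.mul_induction_on' with
  | mem_mul_mem a ha b hb =>
    rw [← sum_homogeneousComponent a, Finset.sum_mul, map_sum]
    refine Submodule.sum_mem _ fun i _ => ?_
    have hai := homogeneousComponent_isHomogeneous i a
    rcases lt_trichotomy i d with hlt | rfl | hgt
    · rw [hlow _ (hJI (hJ a ha i)) i hlt hai]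
      simp
    · rw [homogeneousComponent_mul_left hai]
      exact Submodule.mul_mem_mul ⟨hJ a ha i, hai⟩
        ⟨hI b hb i, homogeneousComponent_isHomogeneous i b⟩
    · rcases lt_or_ge (d + d) i with h2 | h2
      · rw [homogeneousComponent_mul_left_of_lt hai _ h2]
        exact Submodule.zero_mem _
      · obtain ⟨j, hj⟩ := Nat.exists_eq_add_of_le h2
        rw [hj, homogeneousComponent_mul_left hai, hlow _ (hI b hb j) j (by omega)
          (homogeneousComponent_isHomogeneous j b), mul_zero]
        exact Submodule.zero_mem _
  | add x _ y _ hx hy =>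
    rw [map_add]
    exact Submodule.add_mem _ hx hy

lemma degreePart_lt {I J : Ideal 𝓡} {d : ℕ} (hgen : I = Ideal.span (degreePart I d : Set 𝓡))
    (hJI : J < I) : degreePart J d < degreePart I d := by
  refine lt_of_le_not_ge (fun p hp => ⟨hJI.le hp.1, hp.2⟩) fun hle => hJI.not_ge ?_
  rw [hgen, Ideal.span_le]
  exact fun p hp => (hle hp).1

/-- A proper graded subideal `J` of `I` satisfies `J I ≠ I²` when the products of forms in `I_d`
fill all of `R_{2d}`, of dimension `binom(dim I_d + 1, 2)`. -/
lemma mul_ne_sq_of_lt {I J : Ideal 𝓡} {d : ℕ} (hI : IsGraded I) (hJ : IsGraded J)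
    (hgen : I = Ideal.span (degreePart I d : Set 𝓡))
    (hlow : ∀ p ∈ I, ∀ j < d, p.IsHomogeneous j → p = 0)
    (hrank : Module.finrank k (degreePart I d) = 2 * d + 1)
    (hfull : homogeneousSubmodule (Fin 3) k (d + d) ≤ degreePart I d * degreePart I d)
    (hJI : J < I) : J * I ≠ I ^ 2 := by
  intro heq
  have := finite_mul (degreePart J d) (degreePart I d)
  have hle : homogeneousSubmodule (Fin 3) k (d + d) ≤ degreePart J d * degreePart I d := by
    refine le_trans (fun p hp => mem_degreePart.mpr ⟨?_, hp⟩)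
      (degreePart_mul_le hI hJ hJI.le hlow)
    have hsq : degreePart I d * degreePart I d ≤ (I ^ 2).restrictScalars k :=
      Submodule.mul_le.mpr fun a ha b hb => by
        rw [pow_two]
        exact Ideal.mul_mem_mul ha.1 hb.1
    rw [heq]
    exact hsq (hfull hp)
  have h1 := Submodule.finrank_mono hle
  have h2 := two_mul_finrank_mul_lt (degreePart_lt hgen hJI)
  have h3 := two_mul_finrank_homogeneousSubmodule (k := k) (d + d)
  rw [hrank] at h2
  nlinarith

open Pointwise in
/-- If three forms `g` in `I_d` generate `R_{3d}` and `I_d I_d` fills `R_{2d}`, then `(g)` is a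
reduction of `I`, with `I³ = (g) I²`. -/
lemma pow_three_eq_span_mul {I : Ideal 𝓡} {d : ℕ}
    (hgen : I = Ideal.span (degreePart I d : Set 𝓡))
    (hfull : homogeneousSubmodule (Fin 3) k (d + d) ≤ degreePart I d * degreePart I d)
    {g : Fin 3 → 𝓡} (hg : ∀ i, g i ∈ degreePart I d)
    (hgfull : ∀ p : 𝓡, p.IsHomogeneous (d + (d + d)) → p ∈ Ideal.span (Set.range g)) :
    I ^ 3 = Ideal.span (Set.range g) * I ^ 2 := by
  have hsq : degreePart I d * degreePart I d ≤ (I ^ 2).restrictScalars k :=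
    Submodule.mul_le.mpr fun a ha b hb => by
      rw [pow_two]
      exact Ideal.mul_mem_mul ha.1 hb.1
  refine le_antisymm ?_ ?_
  · have hforms : ∀ p : 𝓡, p.IsHomogeneous (d + (d + d)) →
        p ∈ Ideal.span (Set.range g) * I ^ 2 := by
      intro p hp
      obtain ⟨c, hc⟩ := Ideal.mem_span_range_iff_exists_fun.mp (hgfull p hp)
      rw [← homogeneousComponent_eq_self hp, ← hc, map_sum]
      refine Ideal.sum_mem _ fun i _ => ?_
      rw [mul_comm (c i), homogeneousComponent_mul_left (hg i).2]
      exact Ideal.mul_mem_mul (Ideal.subset_span ⟨i, rfl⟩)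
        (hsq (hfull (homogeneousComponent_isHomogeneous _ _)))
    have hcube : I ^ 3 = Ideal.span ((degreePart I d : Set 𝓡) *
        ((degreePart I d : Set 𝓡) * (degreePart I d : Set 𝓡))) := by
      rw [← Ideal.span_mul_span', ← Ideal.span_mul_span', ← hgen, pow_three]
    rw [hcube, Ideal.span_le]
    rintro _ ⟨a, ha, _, ⟨b, hb, c, hc, rfl⟩, rfl⟩
    exact hforms _ (ha.2.mul (hb.2.mul hc.2))
  · rw [pow_succ' I 2]
    refine Ideal.mul_mono_left (Ideal.span_le.mpr ?_)
    rintro _ ⟨i, rfl⟩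
    exact (hg i).1

lemma exists_span_range_reduction [Infinite k] {I : Ideal 𝓡} {d N : ℕ} (hproper : I ≠ ⊤)
    (hgen : I = Ideal.span (degreePart I d : Set 𝓡)) (hX : ∀ i, X i ^ N ∈ I)
    (hfull : homogeneousSubmodule (Fin 3) k (d + d) ≤ degreePart I d * degreePart I d) :
    ∃ g : Fin 3 → 𝓡, (∀ i, g i ∈ degreePart I d) ∧
      I ^ 3 = Ideal.span (Set.range g) * I ^ 2 := by
  have hne : ∀ {𝔞 : Ideal 𝓡} {g : 𝓡}, 𝔞 ≤ I → (∀ p, g * p ∈ 𝔞 → p ∈ 𝔞) → g ≠ 0 := by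
    rintro 𝔞 _ hle hreg rfl
    exact hproper ((Ideal.eq_top_iff_one I).mpr (hle (hreg 1 (by simp))))
  have hspan : ∀ {g : 𝓡}, g ∈ degreePart I d → Ideal.span {g} ≤ I := fun hg => by
    simpa [Ideal.span_le] using hg.1
  obtain ⟨g₀, hg₀, hreg₀⟩ := exists_regular (𝔞 := ⊥) hgen hX fun u hu => by
    simpa using hu 0
  have h₀ := hne bot_le hreg₀
  obtain ⟨g₁, hg₁, hreg₁⟩ := exists_regular (𝔞 := Ideal.span {g₀}) hgen hX fun u hu =>
    mem_span_singleton_of_X_mul_mem h₀ hu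
  have h₁ := hne (hspan hg₀) hreg₁
  obtain ⟨g₂, hg₂, hreg₂⟩ := exists_regular (𝔞 := Ideal.span {g₀} ⊔ Ideal.span {g₁}) hgen hX
    fun u hu => mem_sup_span_singleton_of_X_mul_mem h₀ hreg₁ hu
  have h₂ := hne (sup_le (hspan hg₀) (hspan hg₁)) hreg₂
  have hg : ∀ i, ![g₀, g₁, g₂] i ∈ degreePart I d := by
    intro i
    fin_cases i
    exacts [hg₀, hg₁, hg₂]
  refine ⟨_, hg, pow_three_eq_span_mul hgen hfull hg fun p hp => ?_⟩
  have hle : Ideal.span {g₀} ⊔ Ideal.span {g₁} ⊔ Ideal.span {g₂} ≤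
      Ideal.span (Set.range ![g₀, g₁, g₂]) := by
    rw [← Ideal.span_union, ← Ideal.span_union]
    refine Ideal.span_mono ?_
    rintro _ ((rfl | rfl) | rfl)
    exacts [⟨0, rfl⟩, ⟨1, rfl⟩, ⟨2, rfl⟩]
  exact hle (homogeneousSubmodule_le_of_regular hg₀.2 hg₁.2 hg₂.2 h₀ h₁ h₂ hreg₁ hreg₂ hp)

lemma map_killX_degreePart_ne_bot {I : Ideal 𝓡} {d N : ℕ}
    (hgen : I = Ideal.span (degreePart I d : Set 𝓡)) (hX : ∀ i, X i ^ N ∈ I) :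
    (degreePart I d).map (killX k).toLinearMap ≠ ⊥ := by
  intro hbot
  have hle : I ≤ RingHom.ker (killX k) := by
    rw [hgen, Ideal.span_le]
    intro p hp
    have : killX k p ∈ (degreePart I d).map (killX k).toLinearMap := ⟨p, hp, rfl⟩
    rw [hbot] at this
    exact this
  have h1 : killX k (X 1 ^ N) = 0 := hle (hX 1)
  rw [map_pow, killX_X (by decide)] at h1
  exact pow_ne_zero N (X_ne_zero _) h1

lemma eq_zero_of_mem_of_lt {I : Ideal 𝓡} {d : ℕ}
    (hgen : I = Ideal.span (degreePart I d : Set 𝓡)) :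
    ∀ p ∈ I, ∀ j < d, p.IsHomogeneous j → p = 0 := by
  intro p hp j hj hpj
  have hp' : p ∈ Ideal.span (degreePart I d : Set 𝓡) := by rw [← hgen]; exact hp
  have := apply_mem_of_mem_span (homogeneousComponent j) ⊥ (fun g hg r => by
    rw [homogeneousComponent_mul_left_of_lt hg.2 r hj]
    exact Submodule.zero_mem _) hp'
  rwa [homogeneousComponent_eq_self hpj, Submodule.mem_bot] at this

end Reduction
end GorensteinReduction

open GorensteinReduction

/-- Over an infinite field of characteristic `≠ 2`, a codimension-3 Gorenstein ideal
`I ⊆ k[x,y,z]` with datum `(d, 2d+1)` has reduction number `2`: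
(1) there is an ideal `J ⊆ I` generated by 3 forms of degree `d` with `I³ = J·I²`, and
(2) for every homogeneous ideal `J` strictly contained in `I`, `J·I ≠ I²`. -/
theorem stmt11 {k : Type*} [Field k] (hinf : Infinite k) (hchar : ringChar k ≠ 2)
    (d : ℕ) (hd : 2 ≤ d)
    (I : Ideal (MvPolynomial (Fin 3) k))
    (hproper : I ≠ ⊤)
    (hprim : ∃ N : ℕ, 1 ≤ N ∧ (mIdeal k) ^ N ≤ I)
    (hgen : I = Ideal.span
      ((I.restrictScalars k ⊓ homogeneousSubmodule (Fin 3) k d : Submodule k _) : Set _))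
    (hrank : Module.finrank k ↥(I.restrictScalars k ⊓ homogeneousSubmodule (Fin 3) k d)
      = 2 * d + 1)
    (hsoc : socDim I = 1) :
    (∃ (g : Fin 3 → MvPolynomial (Fin 3) k),
        (∀ i, (g i).IsHomogeneous d)
        ∧ Ideal.span (Set.range g) ≤ I
        ∧ I ^ 3 = Ideal.span (Set.range g) * I ^ 2)
    ∧ ∀ J : Ideal (MvPolynomial (Fin 3) k),
        (∃ S : Set (MvPolynomial (Fin 3) k),
          (∀ h ∈ S, ∃ t : ℕ, h.IsHomogeneous t) ∧ J = Ideal.span S) →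
        J < I → J * I ≠ I ^ 2 := by
  change I = Ideal.span (degreePart I d : Set _) at hgen
  change Module.finrank k (degreePart I d) = _ at hrank
  have hI : IsGraded I := by
    rw [hgen]
    exact isGraded_span fun f hf => ⟨d, hf.2⟩
  have hlow := eq_zero_of_mem_of_lt hgen
  obtain ⟨s, Λ, hΛ⟩ := exists_isDualGenerator hI hprim hproper hsoc
  obtain ⟨N, -, hN⟩ := hprim
  have hX : ∀ i, X i ^ N ∈ I := fun i =>
    hN (mem_mIdeal_pow_of_isHomogeneous (isHomogeneous_X_pow i N) le_rfl)
  have hs₁ := hΛ.two_mul_le_socle_degree hd hrank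
  have hs₂ := hΛ.socle_degree_le_two_mul hd hlow hrank (map_killX_degreePart_ne_bot hgen hX)
  have hfull : homogeneousSubmodule (Fin 3) k (d + d) ≤ degreePart I d * degreePart I d := by
    obtain ⟨c, rfl⟩ := Nat.exists_eq_add_of_le' hd
    obtain rfl : s = 2 * c + 2 := by omega
    exact homogeneousSubmodule_le_mul hΛ hgen hlow
  refine ⟨?_, ?_⟩
  · obtain ⟨g, hg, hg3⟩ := exists_span_range_reduction hproper hgen hX hfull
    refine ⟨g, fun i => (hg i).2, Ideal.span_le.mpr ?_, hg3⟩
    rintro _ ⟨i, rfl⟩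
    exact (hg i).1
  · rintro J ⟨S, hS, rfl⟩ hJI
    exact mul_ne_sq_of_lt hI (isGraded_span hS) hgen hlow hrank hfull hJI
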